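/- arXiv:2009.03760 — 2 statements merged into one kernel-verified Lean document; each statement's English description precedes it below -/
import Mathlib

section
/- Let R be a Lie conformal superalgebra and α, β : R → R two commuting even ℂ-linear maps such that α∂ = ∂α, β∂ = ∂β, α([a_λ b]) = [α(a)_λ α(b)] and β([a_λ b]) = [β(a)_λ β(b)] for all a, b ∈ R. Define [a_λ b]′ = [α(a)_λ β(b)]. Then (R, [·_λ·]′, α, β) is a BiHom-Lie conformal superalgebra. -/
/- ## Conventions

A (ℤ₂-graded) `ℂ[∂]`-module is a complex vector space `R` together with
`D : Module.End ℂ R` (the action of `∂`) and a grading `G : ZMod 2 → Submodule ℂ R`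
which is an internal direct sum decomposition.

A `λ`-bracket `R ⊗ R → ℂ[λ] ⊗ R` is encoded by its coefficients:
`br : ℕ → R → R → R`, where `[a_λ b] = ∑ₙ λⁿ • br n a b` (a finite sum, by the
`locality` axiom which expresses that the values really lie in `ℂ[λ] ⊗ R`).
All axioms of the various kinds of conformal superalgebras are expressed below by
comparing coefficients of the polynomial identities in `λ` (and `μ`). -/

noncomputable section

open Finset

/-- The super-sign `(-1)^{|i||j|}`. -/
def sgn (i j : ZMod 2) : ℂ := (-1 : ℂ) ^ (i.val * j.val)

/-- `prev g n = g (n-1)`, with the convention that it vanishes for `n = 0`.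
If `g` lists the coefficients of a polynomial `p(λ)`, then `prev g` lists the
coefficients of `λ * p(λ)`. -/
def prev {M : Type*} [Zero M] (g : ℕ → M) : ℕ → M
  | 0 => 0
  | n + 1 => g n

/-- If `g` lists the coefficients of a polynomial `p(λ)` with coefficients in the
`ℂ[∂]`-module `(M, DM)`, then `nsub DM g` lists the coefficients of `p(-λ-∂)`. -/
def nsub {M : Type*} [AddCommGroup M] [Module ℂ M] (DM : Module.End ℂ M)
    (g : ℕ → M) (n : ℕ) : M :=
  ∑ᶠ j : ℕ, (((-1 : ℂ) ^ (n + j)) * ((n + j).choose n : ℂ)) • (DM ^ j) (g (n + j))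

/-- Bilinearity (over `ℂ`) of a `λ`-product with coefficients `br`. -/
structure IsBil {R M : Type*} [AddCommGroup R] [Module ℂ R] [AddCommGroup M] [Module ℂ M]
    (br : ℕ → R → M → M) : Prop where
  add_left : ∀ (n : ℕ) (a b : R) (v : M), br n (a + b) v = br n a v + br n b v
  smul_left : ∀ (n : ℕ) (t : ℂ) (a : R) (v : M), br n (t • a) v = t • br n a v
  add_right : ∀ (n : ℕ) (a : R) (v w : M), br n a (v + w) = br n a v + br n a w
  smul_right : ∀ (n : ℕ) (t : ℂ) (a : R) (v : M), br n a (t • v) = t • br n a v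

/-- A Lie conformal superalgebra structure on the ℤ₂-graded `ℂ[∂]`-module `(R, G, D)` with
`λ`-bracket coefficients `br` (`[a_λ b] = ∑ₙ λⁿ • br n a b`):
conformal sesquilinearity `[(∂a)_λ b] = -λ[a_λ b]`, skew-symmetry
`[a_λ b] = -(-1)^{|a||b|} [b_{-λ-∂} a]` and the Jacobi identity
`[a_λ [b_μ c]] = [[a_λ b]_{λ+μ} c] + (-1)^{|a||b|} [b_μ [a_λ c]]`,
all written out in coefficients of `λ^n μ^m`. -/
structure IsLieConfSuperAlg {R : Type*} [AddCommGroup R] [Module ℂ R]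
    (G : ZMod 2 → Submodule ℂ R) (D : Module.End ℂ R) (br : ℕ → R → R → R) : Prop where
  internal : DirectSum.IsInternal G
  der_even : ∀ (i : ZMod 2) (a : R), a ∈ G i → D a ∈ G i
  bil : IsBil br
  grade : ∀ (i j : ZMod 2) (n : ℕ) (a b : R), a ∈ G i → b ∈ G j → br n a b ∈ G (i + j)
  locality : ∀ a b, ∃ N, ∀ n ≥ N, br n a b = 0
  sesq : ∀ (n : ℕ) (a b : R), br n (D a) b = - prev (fun m => br m a b) n
  skew : ∀ (i j : ZMod 2) (n : ℕ) (a b : R), a ∈ G i → b ∈ G j →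
    br n a b = -(sgn i j) • nsub D (fun m => br m b a) n
  jacobi : ∀ (i j : ZMod 2) (m n : ℕ) (a b c : R), a ∈ G i → b ∈ G j →
    br m a (br n b c) =
      (∑ s ∈ range (m + 1), (((n + s).choose s : ℂ)) • br (n + s) (br (m - s) a b) c)
      + sgn i j • br n b (br m a c)

/-- A BiHom-Lie conformal superalgebra structure on `(R, G, D)` with structure maps
`al`, `be` and `λ`-bracket coefficients `br`. The axioms are those of the definition:
`α∂ = ∂α`, `β∂ = ∂β`, `α` and `β` commute, are even, and preserve the bracket;
conformal sesquilinearity `[(∂a)_λ b] = -λ[a_λ b]`, `[a_λ (∂b)] = (∂+λ)[a_λ b]`;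
BiHom-skew-symmetry `[β(a)_λ α(b)] = -(-1)^{|a||b|} [β(b)_{-λ-∂} α(a)]`; and the
BiHom-Jacobi identity
`[αβ(a)_λ [b_μ c]] = [[β(a)_λ b]_{λ+μ} β(c)] + (-1)^{|a||b|} [β(b)_μ [α(a)_λ c]]`,
written out in coefficients. -/
structure IsBiHomLieConfSuperAlg {R : Type*} [AddCommGroup R] [Module ℂ R]
    (G : ZMod 2 → Submodule ℂ R) (D : Module.End ℂ R)
    (al be : Module.End ℂ R) (br : ℕ → R → R → R) : Prop where
  internal : DirectSum.IsInternal G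
  der_even : ∀ (i : ZMod 2) (a : R), a ∈ G i → D a ∈ G i
  al_even : ∀ (i : ZMod 2) (a : R), a ∈ G i → al a ∈ G i
  be_even : ∀ (i : ZMod 2) (a : R), a ∈ G i → be a ∈ G i
  al_be_comm : ∀ a, al (be a) = be (al a)
  al_der : ∀ a, al (D a) = D (al a)
  be_der : ∀ a, be (D a) = D (be a)
  bil : IsBil br
  grade : ∀ (i j : ZMod 2) (n : ℕ) (a b : R), a ∈ G i → b ∈ G j → br n a b ∈ G (i + j)
  locality : ∀ a b, ∃ N, ∀ n ≥ N, br n a b = 0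
  al_br : ∀ (n : ℕ) (a b : R), al (br n a b) = br n (al a) (al b)
  be_br : ∀ (n : ℕ) (a b : R), be (br n a b) = br n (be a) (be b)
  sesq₁ : ∀ (n : ℕ) (a b : R), br n (D a) b = - prev (fun m => br m a b) n
  sesq₂ : ∀ (n : ℕ) (a b : R), br n a (D b) = D (br n a b) + prev (fun m => br m a b) n
  skew : ∀ (i j : ZMod 2) (n : ℕ) (a b : R), a ∈ G i → b ∈ G j →
    br n (be a) (al b) = -(sgn i j) • nsub D (fun m => br m (be b) (al a)) n
  jacobi : ∀ (i j : ZMod 2) (m n : ℕ) (a b c : R), a ∈ G i → b ∈ G j →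
    br m (al (be a)) (br n b c) =
      (∑ s ∈ range (m + 1), (((n + s).choose s : ℂ)) • br (n + s) (br (m - s) (be a) b) (be c))
      + sgn i j • br n (be b) (br m (al a) c)

theorem nsub_eq_sum_range {M : Type*} [AddCommGroup M] [Module ℂ M] (D : Module.End ℂ M)
    (g : ℕ → M) {N : ℕ} (hg : ∀ n ≥ N, g n = 0) (n : ℕ) :
    nsub D g n =
      ∑ j ∈ range N, (((-1 : ℂ) ^ (n + j)) * ((n + j).choose n : ℂ)) • (D ^ j) (g (n + j)) := by
  refine finsum_eq_sum_of_support_subset _ fun j hj => ?_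
  by_contra h
  have hN : N ≤ j := by simpa using h
  exact hj (by simp [hg (n + j) (by omega)])

/-- Substituting `-λ-∂` into `λ * p(λ)` gives `-(λ+∂) * p(-λ-∂)`. -/
theorem nsub_prev {M : Type*} [AddCommGroup M] [Module ℂ M] (D : Module.End ℂ M)
    (g : ℕ → M) {N : ℕ} (hg : ∀ n ≥ N, g n = 0) (n : ℕ) :
    nsub D (prev g) n = -(D (nsub D g n) + prev (nsub D g) n) := by
  have hp : ∀ n ≥ N + 1, prev g n = 0 := by
    rintro (_ | k) hk
    · rfl
    · exact hg k (by omega)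
  rw [nsub_eq_sum_range D _ hp, nsub_eq_sum_range D _ hg]
  cases n with
  | zero =>
    rw [sum_range_succ', map_sum]
    simp only [prev, smul_zero, map_zero, add_zero, ← sum_neg_distrib]
    refine sum_congr rfl fun j _ => ?_
    simp [← add_assoc, pow_succ', ← neg_smul]
  | succ n =>
    have hg' : ∀ n ≥ N + 1, g n = 0 := fun n hn => hg n (by omega)
    have hsplit : ∀ j, (((-1 : ℂ) ^ (n + 1 + j)) * ((n + 1 + j).choose (n + 1) : ℂ)) •
        (D ^ j) (prev g (n + 1 + j)) =
        -((((-1 : ℂ) ^ (n + j)) * ((n + j).choose n : ℂ)) • (D ^ j) (g (n + j))) +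
        -((((-1 : ℂ) ^ (n + j)) * ((n + j).choose (n + 1) : ℂ)) • (D ^ j) (g (n + j))) := by
      intro j
      rw [show n + 1 + j = (n + j) + 1 by omega, Nat.choose_succ_succ]
      simp only [prev]
      push_cast
      module
    simp only [hsplit, sum_add_distrib, sum_neg_distrib]
    rw [show prev (nsub D g) (n + 1) = nsub D g n from rfl, nsub_eq_sum_range D _ hg',
      neg_add, add_comm]
    congr 2
    rw [sum_range_succ', map_sum]
    simp only [add_zero, Nat.choose_succ_self, Nat.cast_zero, mul_zero, zero_smul]
    refine sum_congr rfl fun j _ => ?_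
    rw [map_smul, ← Module.End.mul_apply, ← pow_succ', show n + (j + 1) = n + 1 + j by omega]

theorem nsub_neg {M : Type*} [AddCommGroup M] [Module ℂ M] (D : Module.End ℂ M)
    (g : ℕ → M) (n : ℕ) : nsub D (fun m => -g m) n = -nsub D g n := by
  simp [nsub, finsum_neg_distrib]

theorem prev_smul {M : Type*} [AddCommGroup M] [Module ℂ M] (t : ℂ) (g : ℕ → M) (n : ℕ) :
    prev (fun m => t • g m) n = t • prev g n := by
  cases n <;> simp [prev]

theorem prev_add {M : Type*} [AddCommGroup M] (f g : ℕ → M) (n : ℕ) :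
    prev (fun m => f m + g m) n = prev f n + prev g n := by
  cases n <;> simp [prev]

namespace IsLieConfSuperAlg

variable {R : Type*} [AddCommGroup R] [Module ℂ R] {G : ZMod 2 → Submodule ℂ R}
  {D : Module.End ℂ R} {br : ℕ → R → R → R}

theorem homogeneous_induction (hR : IsLieConfSuperAlg G D br) {p : R → Prop}
    (mem : ∀ i, ∀ a ∈ G i, p a) (h_add : ∀ a b, p a → p b → p (a + b)) (a : R) : p a :=
  Submodule.iSup_induction G (motive := p)
    (hR.internal.submodule_iSup_eq_top ▸ Submodule.mem_top : a ∈ ⨆ i, G i)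
    mem (mem 0 0 (zero_mem _)) h_add

theorem sesq_right_of_mem (hR : IsLieConfSuperAlg G D br) {i j : ZMod 2} {a b : R}
    (ha : a ∈ G i) (hb : b ∈ G j) (n : ℕ) :
    br n a (D b) = D (br n a b) + prev (fun m => br m a b) n := by
  obtain ⟨N, hN⟩ := hR.locality b a
  have hskew : (fun m => br m a b) =
      fun m => -(sgn i j) • nsub D (fun m => br m b a) m :=
    funext fun m => hR.skew i j m a b ha hb
  rw [hR.skew i j n a (D b) ha (hR.der_even j b hb), hR.skew i j n a b ha hb, hskew, prev_smul]
  simp only [hR.sesq]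
  rw [nsub_neg, nsub_prev D _ hN, map_smul, neg_neg, smul_add]

/-- Sesquilinearity in the second argument, `[a_λ (∂b)] = (∂+λ)[a_λ b]`. -/
theorem sesq_right (hR : IsLieConfSuperAlg G D br) (n : ℕ) (a b : R) :
    br n a (D b) = D (br n a b) + prev (fun m => br m a b) n := by
  induction a using hR.homogeneous_induction with
  | mem i a ha =>
    induction b using hR.homogeneous_induction with
    | mem j b hb => exact hR.sesq_right_of_mem ha hb n
    | h_add b c hb hc =>
      simp only [map_add, hR.bil.add_right, prev_add, hb, hc]
      abel
  | h_add a c ha hc =>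
    simp only [map_add, hR.bil.add_left, prev_add, ha, hc]
    abel

end IsLieConfSuperAlg

/-- Let `R` be a Lie conformal superalgebra and `α, β : R → R` two
commuting even `ℂ`-linear maps such that `α∂ = ∂α`, `β∂ = ∂β`,
`α([a_λ b]) = [α(a)_λ α(b)]` and `β([a_λ b]) = [β(a)_λ β(b)]`. Then `R` with the
λ-bracket `[a_λ b]′ = [α(a)_λ β(b)]` and structure maps `α, β` is a BiHom-Lie conformal
superalgebra. -/
theorem lieConfSuperAlg_yau_twist {R : Type*} [AddCommGroup R] [Module ℂ R]
    (G : ZMod 2 → Submodule ℂ R) (D : Module.End ℂ R) (br : ℕ → R → R → R)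
    (hR : IsLieConfSuperAlg G D br)
    (al be : Module.End ℂ R)
    (hal_even : ∀ (i : ZMod 2) (a : R), a ∈ G i → al a ∈ G i)
    (hbe_even : ∀ (i : ZMod 2) (a : R), a ∈ G i → be a ∈ G i)
    (hcomm : ∀ a, al (be a) = be (al a))
    (hal_der : ∀ a, al (D a) = D (al a))
    (hbe_der : ∀ a, be (D a) = D (be a))
    (hal_br : ∀ (n : ℕ) (a b : R), al (br n a b) = br n (al a) (al b))
    (hbe_br : ∀ (n : ℕ) (a b : R), be (br n a b) = br n (be a) (be b)) :
    IsBiHomLieConfSuperAlg G D al be (fun n a b => br n (al a) (be b)) := by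
  exact {
    internal := hR.internal
    der_even := hR.der_even
    al_even := hal_even
    be_even := hbe_even
    al_be_comm := hcomm
    al_der := hal_der
    be_der := hbe_der
    bil :=
      { add_left := fun n a b v => by simp [hR.bil.add_left]
        smul_left := fun n t a v => by simp [hR.bil.smul_left]
        add_right := fun n a v w => by simp [hR.bil.add_right]
        smul_right := fun n t a v => by simp [hR.bil.smul_right] }
    grade := fun i j n a b ha hb => hR.grade i j n _ _ (hal_even i a ha) (hbe_even j b hb)
    locality := fun a b => hR.locality (al a) (be b)
    al_br := fun n a b => by simp only [hal_br, hcomm]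
    be_br := fun n a b => by simp only [hbe_br, hcomm]
    sesq₁ := fun n a b => by rw [hal_der, hR.sesq]
    sesq₂ := fun n a b => by rw [hbe_der, hR.sesq_right]
    skew := fun i j n a b ha hb => by
      simp only [hcomm]
      exact hR.skew i j n _ _ (hbe_even i _ (hal_even i a ha)) (hbe_even j _ (hal_even j b hb))
    jacobi := fun i j m n a b c ha hb => by
      simp only [hal_br, hbe_br, hcomm]
      exact hR.jacobi i j m n _ _ _ (hbe_even i _ (hal_even i _ (hal_even i a ha)))
        (hbe_even j _ (hal_even j b hb)) }
end
end

section
/- Let (R, α, β) be a regular BiHom-Lie conformal superalgebra and (M, φ, ψ) a BiHom-conformal module of R with representation ρ, where φ and ψ are invertible. Define on R ⊕ M, with grading (R ⊕ M)_θ = R_θ ⊕ M_θ, the λ-bracket [(r + m)_λ (r′ + m′)]_M = [r_λ r′] + ρ(r)_λ m′ − (−1)^{|r′||m|} ρ(α^{−1}β(r′))_{−∂−λ} (φψ^{−1}(m)). Then (R ⊕ M, [·_λ·]_M, α + φ, β + ψ) is a BiHom-Lie conformal superalgebra (the semidirect product R ⋉_ρ M). -/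
/- ## Conventions

A (ℤ₂-graded) `ℂ[∂]`-module is a complex vector space `R` together with
`D : Module.End ℂ R` (the action of `∂`) and a grading `G : ZMod 2 → Submodule ℂ R`
which is an internal direct sum decomposition.

A `λ`-bracket `R ⊗ R → ℂ[λ] ⊗ R` is encoded by its coefficients:
`br : ℕ → R → R → R`, where `[a_λ b] = ∑ₙ λⁿ • br n a b` (a finite sum, by the
`locality` axiom which expresses that the values really lie in `ℂ[λ] ⊗ R`).
All axioms of the various kinds of conformal superalgebras are expressed below by
comparing coefficients of the polynomial identities in `λ` (and `μ`). -/

noncomputable section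

open Finset

/-- A BiHom-conformal module `(M, GM, DM, ph, ps)` over the BiHom-Lie conformal
superalgebra `(R, G, D, al, be, br)`, with representation coefficients
`rep : ℕ → R → M → M` (`ρ(a)_λ v = ∑ₙ λⁿ • rep n a v`). The axioms are:
`ρ(∂a)_λ = −λρ(a)_λ`, `ρ(a)_λ ∘ ∂_M = (∂_M + λ) ∘ ρ(a)_λ`, `φ∘ρ(a)_λ = ρ(α(a))_λ∘φ`,
`ψ∘ρ(a)_λ = ρ(β(a))_λ∘ψ`, and
`ρ([β(a)_λ b])_{λ+μ} ∘ ψ = ρ(αβ(a))_λ ∘ ρ(b)_μ − (−1)^{|a||b|} ρ(β(b))_μ ∘ ρ(α(a))_λ`,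
written out in coefficients. -/
structure IsBiHomConfRep {R M : Type*} [AddCommGroup R] [Module ℂ R]
    [AddCommGroup M] [Module ℂ M]
    (G : ZMod 2 → Submodule ℂ R) (D al be : Module.End ℂ R) (br : ℕ → R → R → R)
    (GM : ZMod 2 → Submodule ℂ M) (DM ph ps : Module.End ℂ M)
    (rep : ℕ → R → M → M) : Prop where
  internal : DirectSum.IsInternal GM
  dm_even : ∀ (i : ZMod 2) (v : M), v ∈ GM i → DM v ∈ GM i
  ph_even : ∀ (i : ZMod 2) (v : M), v ∈ GM i → ph v ∈ GM i
  ps_even : ∀ (i : ZMod 2) (v : M), v ∈ GM i → ps v ∈ GM i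
  ph_ps_comm : ∀ v, ph (ps v) = ps (ph v)
  ph_dm : ∀ v, ph (DM v) = DM (ph v)
  ps_dm : ∀ v, ps (DM v) = DM (ps v)
  bil : IsBil rep
  grade : ∀ (i j : ZMod 2) (n : ℕ) (a : R) (v : M),
    a ∈ G i → v ∈ GM j → rep n a v ∈ GM (i + j)
  locality : ∀ a v, ∃ N, ∀ n ≥ N, rep n a v = 0
  sesq₁ : ∀ (n : ℕ) (a : R) (v : M), rep n (D a) v = - prev (fun m => rep m a v) n
  sesq₂ : ∀ (n : ℕ) (a : R) (v : M),
    rep n a (DM v) = DM (rep n a v) + prev (fun m => rep m a v) n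
  ph_rep : ∀ (n : ℕ) (a : R) (v : M), ph (rep n a v) = rep n (al a) (ph v)
  ps_rep : ∀ (n : ℕ) (a : R) (v : M), ps (rep n a v) = rep n (be a) (ps v)
  module_axiom : ∀ (i j : ZMod 2) (m n : ℕ) (a b : R) (v : M), a ∈ G i → b ∈ G j →
    (∑ s ∈ Finset.range (m + 1),
        (((n + s).choose s : ℂ)) • rep (n + s) (br (m - s) (be a) b) (ps v))
      = rep m (al (be a)) (rep n b v) - sgn i j • rep n (be b) (rep m (al a) v)

/-- A sequence of coefficients with only finitely many nonzero terms. -/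
def EventuallyZero {M : Type*} [Zero M] (g : ℕ → M) : Prop := ∃ N, ∀ n ≥ N, g n = 0

/-- A double sequence of coefficients with only finitely many nonzero terms. -/
def EventuallyZero₂ {M : Type*} [Zero M] (c : ℕ → ℕ → M) : Prop :=
  ∃ N, ∀ m n, N ≤ m ∨ N ≤ n → c m n = 0

/-- The value `∑ₙ Xⁿ gₙ` of the polynomial with coefficients `g` at the operator `X`. -/
def opEval {M : Type*} [AddCommGroup M] [Module ℂ M] (X : Module.End ℂ M) (g : ℕ → M) : M :=
  ∑ᶠ n, (X ^ n) (g n)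

/-- If `F k l` are the coefficients of `p(κ, λ) = ∑ κᵏ λˡ F k l`, then `shiftCoeff F m n` are
the coefficients of `λᵐ μⁿ` in `p(λ + μ, λ)`. -/
def shiftCoeff {M : Type*} [AddCommGroup M] [Module ℂ M] (F : ℕ → ℕ → M) (m n : ℕ) : M :=
  ∑ s ∈ range (m + 1), ((n + s).choose s : ℂ) • F (n + s) (m - s)

lemma EventuallyZero₂.flip {M : Type*} [Zero M] {c : ℕ → ℕ → M} (hc : EventuallyZero₂ c) :
    EventuallyZero₂ (fun m n => c n m) :=
  let ⟨A, hA⟩ := hc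
  ⟨A, fun m n h => hA n m h.symm⟩

lemma EventuallyZero₂.right {M : Type*} [Zero M] {c : ℕ → ℕ → M} (hc : EventuallyZero₂ c) (m : ℕ) :
    EventuallyZero (c m) :=
  let ⟨A, hA⟩ := hc
  ⟨A, fun n h => hA m n (.inr h)⟩

lemma EventuallyZero.prev {M : Type*} [Zero M] {g : ℕ → M} (hg : EventuallyZero g) :
    EventuallyZero (prev g) := by
  obtain ⟨A, hA⟩ := hg
  refine ⟨A + 1, fun n hn => ?_⟩
  obtain ⟨k, rfl⟩ : ∃ k, n = k + 1 := ⟨n - 1, by omega⟩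
  exact hA k (by omega)

lemma EventuallyZero.add {M : Type*} [AddZeroClass M] {g h : ℕ → M} (hg : EventuallyZero g)
    (hh : EventuallyZero h) : EventuallyZero (fun n => g n + h n) := by
  obtain ⟨A, hA⟩ := hg
  obtain ⟨B, hB⟩ := hh
  refine ⟨max A B, fun n hn => ?_⟩
  simp [hA n (le_trans (le_max_left _ _) hn), hB n (le_trans (le_max_right _ _) hn)]

lemma EventuallyZero₂.add {M : Type*} [AddZeroClass M]
    {c d : ℕ → ℕ → M} (hc : EventuallyZero₂ c) (hd : EventuallyZero₂ d) :
    EventuallyZero₂ (fun m n => c m n + d m n) := by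
  obtain ⟨A, hA⟩ := hc
  obtain ⟨B, hB⟩ := hd
  exact ⟨max A B, fun m n h => by simp [hA m n (by omega), hB m n (by omega)]⟩

section Signs

lemma sgn_comm (i j : ZMod 2) : sgn i j = sgn j i := by
  simp [sgn, mul_comm]

lemma sgn_mul_self (i j : ZMod 2) : sgn i j * sgn i j = 1 := by
  rw [sgn, ← mul_pow]; simp

lemma sgn_add_right (i j k : ZMod 2) : sgn i (j + k) = sgn i j * sgn i k := by
  have h (x : ZMod 2) : x = 0 ∨ x = 1 := by revert x; decide
  have h11 : (1 : ZMod 2) + 1 = 0 := by decide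
  have h1 : (1 : ZMod 2).val = 1 := rfl
  rcases h i with rfl | rfl <;> rcases h j with rfl | rfl <;> rcases h k with rfl | rfl <;>
    simp [sgn, h11, h1]

lemma sgn_add_left (i j k : ZMod 2) : sgn (i + j) k = sgn i k * sgn j k := by
  rw [sgn_comm, sgn_add_right, sgn_comm k, sgn_comm k]

end Signs

section Coefficients

variable {M N : Type*} [AddCommGroup M] [Module ℂ M] [AddCommGroup N] [Module ℂ N]

lemma EventuallyZero.map {g : ℕ → M} (hg : EventuallyZero g) (f : M →ₗ[ℂ] N) :
    EventuallyZero (fun n => f (g n)) := by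
  obtain ⟨A, hA⟩ := hg
  exact ⟨A, fun n hn => by simp [hA n hn]⟩

lemma EventuallyZero.smul {g : ℕ → M} (hg : EventuallyZero g) (t : ℂ) :
    EventuallyZero (fun n => t • g n) :=
  hg.map (t • LinearMap.id)

lemma opEval_eq_sum (X : Module.End ℂ M) {g : ℕ → M} {A : ℕ} (h : ∀ n ≥ A, g n = 0) :
    opEval X g = ∑ n ∈ range A, (X ^ n) (g n) := by
  refine finsum_eq_sum_of_support_subset _ fun n hn => ?_
  by_contra hc
  exact hn (by simp [h n (by simpa using hc)])

lemma nsub_eq_sum (D : Module.End ℂ M) {g : ℕ → M} {A : ℕ} (h : ∀ n ≥ A, g n = 0) (n : ℕ) :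
    nsub D g n =
      ∑ j ∈ range A, ((-1 : ℂ) ^ (n + j) * ((n + j).choose n : ℂ)) • (D ^ j) (g (n + j)) := by
  refine finsum_eq_sum_of_support_subset _ fun j hj => ?_
  by_contra hc
  have : A ≤ j := by simpa using hc
  exact hj (by simp [h (n + j) (by omega)])

lemma nsub_eq_zero (D : Module.End ℂ M) {g : ℕ → M} {A : ℕ} (h : ∀ n ≥ A, g n = 0) :
    ∀ n ≥ A, nsub D g n = 0 := fun n hn => by
  rw [nsub_eq_sum D h]
  exact sum_eq_zero fun j _ => by rw [h (n + j) (by omega), map_zero, smul_zero]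

lemma EventuallyZero.nsub {g : ℕ → M} (hg : EventuallyZero g) (D : Module.End ℂ M) :
    EventuallyZero (nsub D g) :=
  let ⟨A, hA⟩ := hg
  ⟨A, nsub_eq_zero D hA⟩

lemma nsub_mem (D : Module.End ℂ M) {g : ℕ → M} (P : Submodule ℂ M)
    (hD : ∀ v ∈ P, D v ∈ P) (hg : ∀ n, g n ∈ P) (n : ℕ) : nsub D g n ∈ P := by
  have hpow (j : ℕ) : ∀ v ∈ P, (D ^ j) v ∈ P := by
    induction j with
    | zero => simp
    | succ j ih => exact fun v hv => by rw [pow_succ]; exact ih _ (hD v hv)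
  exact finsum_induction (· ∈ P) P.zero_mem (fun _ _ => P.add_mem)
    fun j => P.smul_mem _ (hpow j _ (hg _))

lemma opEval_add {X : Module.End ℂ M} {g h : ℕ → M} (hg : EventuallyZero g)
    (hh : EventuallyZero h) :
    opEval X (fun n => g n + h n) = opEval X g + opEval X h := by
  obtain ⟨A, hA⟩ := hg
  obtain ⟨B, hB⟩ := hh
  have hA' : ∀ n ≥ max A B, g n = 0 := fun n hn => hA n (le_trans (le_max_left _ _) hn)
  have hB' : ∀ n ≥ max A B, h n = 0 := fun n hn => hB n (le_trans (le_max_right _ _) hn)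
  rw [opEval_eq_sum X hA', opEval_eq_sum X hB',
    opEval_eq_sum X (A := max A B) fun n hn => by simp [hA' n hn, hB' n hn], ← sum_add_distrib]
  simp

lemma map_opEval (f : M →ₗ[ℂ] N) {X : Module.End ℂ M} {Y : Module.End ℂ N}
    (hf : ∀ v, f (X v) = Y (f v)) {g : ℕ → M} (hg : EventuallyZero g) :
    f (opEval X g) = opEval Y (fun n => f (g n)) := by
  obtain ⟨A, hA⟩ := hg
  have hpow (n : ℕ) : ∀ v, f ((X ^ n) v) = (Y ^ n) (f v) := by
    induction n with
    | zero => simp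
    | succ n ih => intro v; rw [pow_succ, pow_succ, Module.End.mul_apply, ih, hf,
        Module.End.mul_apply]
  rw [opEval_eq_sum X hA, opEval_eq_sum Y (A := A) fun n hn => by simp [hA n hn], map_sum]
  simp [hpow]

lemma opEval_smul {X : Module.End ℂ M} {g : ℕ → M} (hg : EventuallyZero g) (t : ℂ) :
    opEval X (fun n => t • g n) = t • opEval X g :=
  (map_opEval (t • LinearMap.id : M →ₗ[ℂ] M) (by simp) hg).symm

lemma opEval_neg {X : Module.End ℂ M} {g : ℕ → M} (hg : EventuallyZero g) :
    opEval X (fun n => -g n) = -opEval X g :=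
  (map_opEval (-LinearMap.id : M →ₗ[ℂ] M) (by simp) hg).symm

lemma opEval_zero (X : Module.End ℂ M) : opEval X (fun _ => (0 : M)) = 0 := by
  simp [opEval]

lemma opEval_prev {X : Module.End ℂ M} {g : ℕ → M} (hg : EventuallyZero g) :
    opEval X (prev g) = X (opEval X g) := by
  obtain ⟨A, hA⟩ := hg
  have hp : ∀ n ≥ A + 1, prev g n = 0 := fun n hn => by
    obtain ⟨k, rfl⟩ : ∃ k, n = k + 1 := ⟨n - 1, by omega⟩
    exact hA k (by omega)
  rw [opEval_eq_sum X hp, opEval_eq_sum X hA, sum_range_succ', map_sum]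
  simp [prev, pow_succ']

/-- Evaluating a locally finite sequence of linear maps at an operator. -/
def opEvalMap (X : Module.End ℂ N) (A : ℕ → M →ₗ[ℂ] N)
    (hA : ∀ v, EventuallyZero (fun n => A n v)) : M →ₗ[ℂ] N where
  toFun v := opEval X (fun n => A n v)
  map_add' v w := by simpa using opEval_add (hA v) (hA w)
  map_smul' t v := by simpa using opEval_smul (hA v) t

lemma sum_choose_eq_opEval {X Y : Module.End ℂ M} (hXY : Commute X Y) {g : ℕ → M} {A B : ℕ}
    (h : ∀ n ≥ A, g n = 0) (hAB : A ≤ B) :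
    ∑ s ∈ range B, ∑ n ∈ range B,
      ((n + s).choose s : ℂ) • (X ^ s) ((Y ^ n) (g (n + s))) = opEval (X + Y) g := by
  have h' : ∀ n ≥ B, g n = 0 := fun n hn => h n (le_trans hAB hn)
  rw [opEval_eq_sum _ h']
  have key := sum_range_diag_flip B fun s n =>
    ((n + s).choose s : ℂ) • (X ^ s) ((Y ^ n) (g (n + s)))
  trans ∑ s ∈ range B, ∑ n ∈ range (B - s),
      ((n + s).choose s : ℂ) • (X ^ s) ((Y ^ n) (g (n + s)))
  · refine sum_congr rfl fun s _ => (sum_subset (by simp) fun n _ hn => ?_).symm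
    have : B - s ≤ n := by simpa using hn
    rw [h' (n + s) (by omega)]
    simp
  rw [← key]
  refine sum_congr rfl fun k _ => ?_
  rw [hXY.add_pow, LinearMap.sum_apply]
  refine sum_congr rfl fun s hs => ?_
  have hs' : s ≤ k := by simpa [Nat.lt_succ_iff] using hs
  rw [Nat.sub_add_cancel hs', ← (Nat.cast_commute (k.choose s) (X ^ s * Y ^ (k - s))).eq]
  simp [Module.End.mul_apply, Module.End.natCast_apply, Nat.cast_smul_eq_nsmul]

lemma opEval_nsub {X D : Module.End ℂ M} (hXD : Commute X D) {g : ℕ → M}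
    (hg : EventuallyZero g) : opEval X (nsub D g) = opEval (-X - D) g := by
  obtain ⟨A, hA⟩ := hg
  rw [sub_eq_add_neg, ← sum_choose_eq_opEval hXD.neg_left.neg_right hA le_rfl,
    opEval_eq_sum X (nsub_eq_zero D hA)]
  refine sum_congr rfl fun n _ => ?_
  rw [nsub_eq_sum D hA, map_sum]
  refine sum_congr rfl fun j _ => ?_
  rw [neg_pow X, neg_pow D, map_smul, add_comm n j, pow_add, mul_comm, mul_smul]
  have h1 (Z : Module.End ℂ M) (k : ℕ) (v : M) :
      (((-1 : Module.End ℂ M) ^ k) * Z) v = ((-1 : ℂ) ^ k) • Z v := by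
    rcases Nat.even_or_odd k with hk | hk <;> simp [hk.neg_one_pow]
  rw [h1, h1, map_smul, smul_smul ((-1 : ℂ) ^ n), mul_comm ((-1 : ℂ) ^ n)]

lemma opEval_comm {X Y : Module.End ℂ M} (hXY : Commute X Y) {c : ℕ → ℕ → M}
    (hc : EventuallyZero₂ c) :
    opEval X (fun m => opEval Y (fun n => c m n)) =
      opEval Y (fun n => opEval X (fun m => c m n)) := by
  obtain ⟨A, hA⟩ := hc
  have h1 (m : ℕ) := opEval_eq_sum Y (g := fun n => c m n) (A := A) fun n hn => hA m n (.inr hn)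
  have h2 (n : ℕ) := opEval_eq_sum X (g := fun m => c m n) (A := A) fun m hm => hA m n (.inl hm)
  simp_rw [h1, h2]
  rw [opEval_eq_sum X (A := A) fun m hm => by simp [hA m _ (.inl hm)],
    opEval_eq_sum Y (A := A) fun n hn => by simp [hA _ n (.inr hn)]]
  simp_rw [map_sum]
  rw [sum_comm]
  refine sum_congr rfl fun n _ => sum_congr rfl fun m _ => ?_
  rw [← Module.End.mul_apply, ← Module.End.mul_apply, (hXY.pow_pow m n).eq]

lemma EventuallyZero₂.opEval {c : ℕ → ℕ → M} (hc : EventuallyZero₂ c) (Y : Module.End ℂ M) :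
    EventuallyZero (fun m => opEval Y (c m)) :=
  let ⟨A, hA⟩ := hc
  ⟨A, fun m h => by
    have : c m = fun _ => 0 := funext fun n => hA m n (.inl h)
    simp [this, opEval_zero]⟩

lemma EventuallyZero₂.smul {c : ℕ → ℕ → M} (hc : EventuallyZero₂ c) (t : ℂ) :
    EventuallyZero₂ (fun m n => t • c m n) :=
  let ⟨A, hA⟩ := hc
  ⟨A, fun m n h => by simp [hA m n h]⟩

lemma EventuallyZero₂.shiftCoeff {F : ℕ → ℕ → M} (hF : EventuallyZero₂ F) :
    EventuallyZero₂ (shiftCoeff F) := by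
  obtain ⟨A, hA⟩ := hF
  refine ⟨2 * A, fun m n h => sum_eq_zero fun s hs => ?_⟩
  rw [hA _ _ (by have := mem_range.1 hs; omega), smul_zero]

lemma opEval₂_add {X Y : Module.End ℂ M} {c d : ℕ → ℕ → M} (hc : EventuallyZero₂ c)
    (hd : EventuallyZero₂ d) :
    opEval X (fun m => opEval Y (fun n => c m n + d m n)) =
      opEval X (fun m => opEval Y (c m)) + opEval X (fun m => opEval Y (d m)) := by
  rw [← opEval_add (hc.opEval Y) (hd.opEval Y)]
  congr! 2 with m
  exact opEval_add (hc.right m) (hd.right m)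

lemma opEval₂_smul {X Y : Module.End ℂ M} {c : ℕ → ℕ → M} (hc : EventuallyZero₂ c) (t : ℂ) :
    opEval X (fun m => opEval Y (fun n => t • c m n)) =
      t • opEval X (fun m => opEval Y (c m)) := by
  rw [← opEval_smul (hc.opEval Y)]
  congr! 2 with m
  exact opEval_smul (hc.right m) t

lemma opEval_shiftCoeff {X Y : Module.End ℂ M} (hXY : Commute X Y) {F : ℕ → ℕ → M}
    (hF : EventuallyZero₂ F) :
    opEval X (fun m => opEval Y (shiftCoeff F m)) =
      opEval X (fun l => opEval (X + Y) (fun k => F k l)) := by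
  obtain ⟨A, hA⟩ := hF
  have hS (m n : ℕ) (h : 2 * A ≤ m ∨ 2 * A ≤ n) : shiftCoeff F m n = 0 :=
    sum_eq_zero fun s hs => by
      rw [hA _ _ (by have := mem_range.1 hs; omega), smul_zero]
  have h1 (m : ℕ) := opEval_eq_sum Y (g := shiftCoeff F m) fun n hn => hS m n (.inr hn)
  have h2 (l : ℕ) := sum_choose_eq_opEval hXY (g := fun k => F k l) (A := A) (B := 2 * A)
    (fun k hk => hA k l (.inl hk)) (by omega)
  simp_rw [h1, ← h2]
  rw [opEval_eq_sum X (A := 2 * A) fun m hm => by simp [hS m _ (.inl hm)],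
    opEval_eq_sum X (A := 2 * A) fun m hm => by simp [hA _ m (.inr (by omega : A ≤ m))]]
  let f (s l : ℕ) : M := ∑ n ∈ range (2 * A),
    ((n + s).choose s : ℂ) • (X ^ (s + l)) ((Y ^ n) (F (n + s) l))
  have key := sum_range_diag_flip (2 * A) f
  trans ∑ m ∈ range (2 * A), ∑ s ∈ range (m + 1), f s (m - s)
  · refine sum_congr rfl fun m _ => ?_
    simp_rw [f, shiftCoeff, map_sum]
    rw [sum_comm]
    refine sum_congr rfl fun s hs => sum_congr rfl fun n _ => ?_
    have := mem_range.1 hs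
    simp [show s + (m - s) = m by omega]
  rw [key]
  trans ∑ s ∈ range (2 * A), ∑ l ∈ range (2 * A), f s l
  · refine sum_congr rfl fun s _ => sum_subset (by simp) fun l _ hl => ?_
    have : 2 * A - s ≤ l := by simpa using hl
    exact sum_eq_zero fun n _ => by rw [hA (n + s) l (by omega)]; simp
  rw [sum_comm]
  refine sum_congr rfl fun l _ => ?_
  simp_rw [f, map_sum]
  refine sum_congr rfl fun s _ => sum_congr rfl fun n _ => ?_
  rw [add_comm s l, pow_add, map_smul, Module.End.mul_apply]

lemma eq_of_opEval_eq {g h : ℕ → M} (hg : EventuallyZero g) (hh : EventuallyZero h)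
    (H : ∀ t : ℂ, opEval (algebraMap ℂ (Module.End ℂ M) t) g =
      opEval (algebraMap ℂ (Module.End ℂ M) t) h) : g = h := by
  obtain ⟨A, hA⟩ := hg
  obtain ⟨B, hB⟩ := hh
  have hA' : ∀ n ≥ max A B, g n = 0 := fun n hn => hA n (le_trans (le_max_left _ _) hn)
  have hB' : ∀ n ≥ max A B, h n = 0 := fun n hn => hB n (le_trans (le_max_right _ _) hn)
  funext k
  by_cases hk : max A B ≤ k
  · rw [hA' k hk, hB' k hk]
  rw [← sub_eq_zero, ← Module.forall_dual_apply_eq_zero_iff ℂ]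
  intro f
  let p : Polynomial ℂ := ∑ n ∈ range (max A B), Polynomial.monomial n (f (g n - h n))
  have hp : p = 0 := by
    refine Polynomial.funext fun t => ?_
    have := congrArg f (H t)
    rw [opEval_eq_sum _ hA', opEval_eq_sum _ hB'] at this
    simp only [← map_pow, Module.algebraMap_end_apply, map_sum, map_smul, smul_eq_mul] at this
    simp only [p, Polynomial.eval_finsetSum, Polynomial.eval_monomial, Polynomial.eval_zero]
    simp only [map_sub, sub_mul, sum_sub_distrib]
    rw [sub_eq_zero]
    simpa [mul_comm] using this
  have := congrArg (Polynomial.coeff · k) hp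
  simpa [p, Polynomial.finsetSum_coeff, Polynomial.coeff_monomial,
    show k < A ∨ k < B by omega] using this

lemma eq_of_opEval₂_eq {c d : ℕ → ℕ → M} (hc : EventuallyZero₂ c) (hd : EventuallyZero₂ d)
    (H : ∀ t u : ℂ, opEval (algebraMap ℂ (Module.End ℂ M) t)
        (fun m => opEval (algebraMap ℂ (Module.End ℂ M) u) (c m)) =
      opEval (algebraMap ℂ (Module.End ℂ M) t)
        (fun m => opEval (algebraMap ℂ (Module.End ℂ M) u) (d m))) : c = d := by
  funext m
  refine eq_of_opEval_eq (hc.right m) (hd.right m) fun u => ?_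
  exact congrFun (eq_of_opEval_eq (hc.opEval _) (hd.opEval _) fun t => H t u) m

lemma nsub_nsub (D : Module.End ℂ M) {g : ℕ → M} (hg : EventuallyZero g) :
    nsub D (nsub D g) = g := by
  refine eq_of_opEval_eq ((hg.nsub D).nsub D) hg fun t => ?_
  have ht : Commute (algebraMap ℂ (Module.End ℂ M) t) D := Algebra.commutes t D
  rw [opEval_nsub ht (hg.nsub D), opEval_nsub (ht.neg_left.sub_left (.refl D)) hg]
  congr 1
  abel

lemma nsub_add (D : Module.End ℂ M) {g h : ℕ → M} (hg : EventuallyZero g)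
    (hh : EventuallyZero h) (n : ℕ) :
    nsub D (fun k => g k + h k) n = nsub D g n + nsub D h n := by
  refine congrFun (eq_of_opEval_eq ((hg.add hh).nsub D) ((hg.nsub D).add (hh.nsub D))
    fun t => ?_) n
  have ht : Commute (algebraMap ℂ (Module.End ℂ M) t) D := Algebra.commutes t D
  rw [opEval_nsub ht (hg.add hh), opEval_add hg hh, opEval_add (hg.nsub D) (hh.nsub D),
    opEval_nsub ht hg, opEval_nsub ht hh]

lemma map_nsub (f : M →ₗ[ℂ] N) {D : Module.End ℂ M} {E : Module.End ℂ N}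
    (hf : ∀ v, f (D v) = E (f v)) {g : ℕ → M} (hg : EventuallyZero g) (n : ℕ) :
    f (nsub D g n) = nsub E (fun k => f (g k)) n := by
  obtain ⟨A, hA⟩ := hg
  have hpow (n : ℕ) : ∀ v, f ((D ^ n) v) = (E ^ n) (f v) := by
    induction n with
    | zero => simp
    | succ n ih => intro v; rw [pow_succ, pow_succ, Module.End.mul_apply, ih, hf,
        Module.End.mul_apply]
  rw [nsub_eq_sum D hA, nsub_eq_sum E (A := A) fun n hn => by simp [hA n hn], map_sum]
  simp [hpow]

lemma nsub_smul (D : Module.End ℂ M) {g : ℕ → M} (hg : EventuallyZero g) (t : ℂ) (n : ℕ) :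
    nsub D (fun k => t • g k) n = t • nsub D g n :=
  (map_nsub (t • LinearMap.id : M →ₗ[ℂ] M) (by simp) hg n).symm

end Coefficients

section Grading

variable {V W : Type*} [AddCommGroup V] [Module ℂ V] [AddCommGroup W] [Module ℂ W]

lemma isInternal_iff_isCompl (G : ZMod 2 → Submodule ℂ V) (i : ZMod 2) :
    DirectSum.IsInternal G ↔ IsCompl (G i) (G (i + 1)) :=
  DirectSum.isInternal_submodule_iff_isCompl G (by revert i; decide)
    (by ext x; revert x i; simp only [Set.mem_univ, Set.mem_insert_iff,
      Set.mem_singleton_iff, true_iff]; decide)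

lemma isInternal_prod {G : ZMod 2 → Submodule ℂ V} {H : ZMod 2 → Submodule ℂ W}
    (hG : DirectSum.IsInternal G) (hH : DirectSum.IsInternal H) :
    DirectSum.IsInternal (fun θ => (G θ).prod (H θ)) := by
  rw [isInternal_iff_isCompl _ 0] at *
  refine ⟨?_, ?_⟩
  · rw [disjoint_iff, Submodule.prod_inf_prod, hG.inf_eq_bot, hH.inf_eq_bot,
      Submodule.prod_bot]
  · rw [codisjoint_iff, Submodule.prod_sup_prod, hG.sup_eq_top, hH.sup_eq_top,
      Submodule.prod_top]

lemma homogeneous_induction {G : ZMod 2 → Submodule ℂ V} (hG : DirectSum.IsInternal G)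
    {p : V → Prop} (mem : ∀ i, ∀ x ∈ G i, p x) (add : ∀ x y, p x → p y → p (x + y)) (x : V) :
    p x :=
  Submodule.iSup_induction G (motive := p)
    (by rw [hG.submodule_iSup_eq_top]; trivial) mem (mem 0 0 (G 0).zero_mem) add

lemma symm_mem_of_even {G : ZMod 2 → Submodule ℂ V} (hG : DirectSum.IsInternal G)
    (f : V ≃ₗ[ℂ] V) (hf : ∀ i, ∀ x ∈ G i, f x ∈ G i) (i : ZMod 2) (x : V) (hx : x ∈ G i) :
    f.symm x ∈ G i := by
  have hc := (isInternal_iff_isCompl G i).1 hG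
  obtain ⟨y, hy, z, hz, hyz⟩ := Submodule.mem_sup.1
    (show f.symm x ∈ G i ⊔ G (i + 1) by rw [hc.sup_eq_top]; trivial)
  have hfz : f z = 0 := by
    have h1 : f z = x - f y := by
      rw [eq_sub_iff_add_eq', ← map_add, hyz, f.apply_symm_apply]
    exact Submodule.disjoint_def.1 hc.disjoint _
      (h1 ▸ (G i).sub_mem hx (hf i y hy)) (hf _ z hz)
  rw [← hyz, (map_eq_zero_iff f f.injective).1 hfz, add_zero]
  exact hy

end Grading

section Bilinear

variable {R M : Type*} [AddCommGroup R] [Module ℂ R] [AddCommGroup M] [Module ℂ M]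
  {br : ℕ → R → M → M}

lemma IsBil.zero_left (h : IsBil br) (n : ℕ) (v : M) : br n 0 v = 0 := by
  simpa using h.smul_left n 0 0 v

lemma IsBil.zero_right (h : IsBil br) (n : ℕ) (a : R) : br n a 0 = 0 := by
  simpa using h.smul_right n 0 a 0

/-- The coefficients of a `λ`-product as linear maps in the second argument. -/
def IsBil.toLinearMap (h : IsBil br) (n : ℕ) (a : R) : M →ₗ[ℂ] M where
  toFun := br n a
  map_add' := h.add_right n a
  map_smul' t := h.smul_right n t a

lemma EventuallyZero₂.of_uniform {N : Type*} [Zero N] {c : ℕ → ℕ → N}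
    (h₁ : ∃ A, ∀ n ≥ A, ∀ m, c m n = 0) (h₂ : ∀ n, EventuallyZero (fun m => c m n)) :
    EventuallyZero₂ c := by
  obtain ⟨A, hA⟩ := h₁
  choose B hB using h₂
  refine ⟨A + ∑ n ∈ range A, B n, fun m n h => ?_⟩
  by_cases hn : A ≤ n
  · exact hA n hn m
  · have := single_le_sum (f := B) (fun _ _ => Nat.zero_le _) (mem_range.2 (not_le.1 hn))
    exact hB n m (by omega)

end Bilinear

section Semidirect

variable {R M : Type*} [AddCommGroup R] [Module ℂ R] [AddCommGroup M] [Module ℂ M]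
  {G : ZMod 2 → Submodule ℂ R} {D : Module.End ℂ R} {al be : R ≃ₗ[ℂ] R}
  {br : ℕ → R → R → R}
  {GM : ZMod 2 → Submodule ℂ M} {DM : Module.End ℂ M} {ph ps : M ≃ₗ[ℂ] M}
  {rep : ℕ → R → M → M} {T : ℕ → M → R → M}

/-- `T` lists the coefficients of the right action
`v_λ r = −(−1)^{|r||v|} ρ(α⁻¹β(r))_{−∂−λ} (φψ⁻¹(v))` of `R` on `M`. -/
structure IsRightAction (G : ZMod 2 → Submodule ℂ R) (al be : R ≃ₗ[ℂ] R)
    (GM : ZMod 2 → Submodule ℂ M) (DM : Module.End ℂ M) (ph ps : M ≃ₗ[ℂ] M)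
    (rep : ℕ → R → M → M) (T : ℕ → M → R → M) : Prop where
  add_left : ∀ n v w r, T n (v + w) r = T n v r + T n w r
  add_right : ∀ n v r r', T n v (r + r') = T n v r + T n v r'
  eq_nsub : ∀ (j k : ZMod 2) (n : ℕ) (v : M) (r : R), v ∈ GM j → r ∈ G k →
    T n v r = -(sgn k j) • nsub DM (fun p => rep p (al.symm (be r)) (ph (ps.symm v))) n

lemma IsRightAction.zero_left (hT : IsRightAction G al be GM DM ph ps rep T) (n : ℕ) (r : R) :
    T n 0 r = 0 := by
  simpa using hT.add_left n 0 0 r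

lemma IsRightAction.zero_right (hT : IsRightAction G al be GM DM ph ps rep T) (n : ℕ) (v : M) :
    T n v 0 = 0 := by
  simpa using hT.add_right n v 0 0

lemma symm_comm_of_comm {V : Type*} [AddCommGroup V] [Module ℂ V] (f g : V ≃ₗ[ℂ] V)
    (h : ∀ v, f (g v) = g (f v)) (v : V) : f (g.symm v) = g.symm (f v) := by
  rw [LinearEquiv.eq_symm_apply, ← h, g.apply_symm_apply]

section

variable (hR : IsBiHomLieConfSuperAlg G D al.toLinearMap be.toLinearMap br)
  (hM : IsBiHomConfRep G D al.toLinearMap be.toLinearMap br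
    GM DM ph.toLinearMap ps.toLinearMap rep)
  (hT : IsRightAction G al be GM DM ph ps rep T)

include hR in
lemma symm_alpha_beta_br (n : ℕ) (a b : R) :
    al.symm (be (br n (al a) b)) = br n (be a) (al.symm (be b)) := by
  have h1 := hR.be_br n (al a) b
  have h2 := hR.al_br n (be a) (al.symm (be b))
  have h3 := hR.al_be_comm a
  simp only [LinearEquiv.coe_coe, al.apply_symm_apply] at h1 h2 h3
  rw [LinearEquiv.symm_apply_eq, h1, h2, h3]

include hR in
lemma beta_symm_alpha (a : R) : be (al.symm a) = al.symm (be a) :=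
  symm_comm_of_comm be al (fun v => (hR.al_be_comm v).symm) a

include hM in
lemma phi_symm_psi (v : M) : ph (ps.symm v) = ps.symm (ph v) :=
  symm_comm_of_comm ph ps hM.ph_ps_comm v

include hM in
lemma phi_symm_psi_psi (v : M) : ph (ps.symm (ps v)) = ps (ph (ps.symm v)) := by
  rw [phi_symm_psi hM v, ps.symm_apply_apply, ps.apply_symm_apply]

include hM in
lemma phi_symm_psi_rep (n : ℕ) (a : R) (v : M) :
    ph (ps.symm (rep n (be a) v)) = rep n (al a) (ph (ps.symm v)) := by
  have h1 := hM.ps_rep n a (ps.symm v)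
  have h2 := hM.ph_rep n a (ps.symm v)
  simp only [LinearEquiv.coe_coe, ps.apply_symm_apply] at h1 h2
  rw [← h1, ps.symm_apply_apply, h2]

include hM in
lemma phi_symm_psi_der (v : M) : ph (ps.symm (DM v)) = DM (ph (ps.symm v)) := by
  have h1 := hM.ps_dm (ps.symm v)
  have h2 := hM.ph_dm (ps.symm v)
  simp only [LinearEquiv.coe_coe, ps.apply_symm_apply] at h1 h2
  rw [← h1, ps.symm_apply_apply, h2]

include hR in
lemma symm_alpha_beta_der (a : R) : al.symm (be (D a)) = D (al.symm (be a)) := by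
  have h1 := hR.be_der a
  have h2 := hR.al_der (al.symm (be a))
  simp only [LinearEquiv.coe_coe, al.apply_symm_apply] at h1 h2
  rw [h1, LinearEquiv.symm_apply_eq, h2]

include hR in
lemma alpha_mem {i : ZMod 2} {a : R} (ha : a ∈ G i) : al a ∈ G i := hR.al_even i a ha

include hR in
lemma beta_mem {i : ZMod 2} {a : R} (ha : a ∈ G i) : be a ∈ G i := hR.be_even i a ha

include hM in
lemma phi_mem {i : ZMod 2} {v : M} (hv : v ∈ GM i) : ph v ∈ GM i := hM.ph_even i v hv

include hM in
lemma psi_mem {i : ZMod 2} {v : M} (hv : v ∈ GM i) : ps v ∈ GM i := hM.ps_even i v hv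

include hR in
lemma symm_alpha_beta_mem (i : ZMod 2) (a : R) (ha : a ∈ G i) : al.symm (be a) ∈ G i :=
  symm_mem_of_even hR.internal al hR.al_even i _ (hR.be_even i a ha)

include hM in
lemma phi_symm_psi_mem (i : ZMod 2) (v : M) (hv : v ∈ GM i) : ph (ps.symm v) ∈ GM i :=
  hM.ph_even i _ (symm_mem_of_even hM.internal ps hM.ps_even i v hv)

/-- `opRep X a v` is the value of `ρ(a)_λ v` at the operator `λ = X`. -/
def opRep (X : Module.End ℂ M) (a : R) : Module.End ℂ M :=
  opEvalMap X (fun n => hM.bil.toLinearMap n a) (hM.locality a)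

lemma opRep_apply (X : Module.End ℂ M) (a : R) (v : M) :
    opRep hM X a v = opEval X (fun n => rep n a v) := rfl

lemma opRep_der {X : Module.End ℂ M} (a : R) (v : M) :
    opRep hM X a (DM v) = opEval X (fun n => DM (rep n a v)) + X (opRep hM X a v) := by
  rw [opRep_apply, opRep_apply, ← opEval_prev (hM.locality a v),
    ← opEval_add (EventuallyZero.map (hM.locality a v) DM) (EventuallyZero.prev (hM.locality a v))]
  simp only [hM.sesq₂]

lemma opRep_der_of_commute {X : Module.End ℂ M} (hX : Commute X DM) (a : R) (v : M) :
    opRep hM X a (DM v) = (DM + X) (opRep hM X a v) := by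
  rw [opRep_der, opRep_apply, LinearMap.add_apply,
    map_opEval DM (fun v => (LinearMap.congr_fun hX.eq v).symm) (hM.locality a v)]

include hM in
lemma eventuallyZero₂_rep (a : R) {g : ℕ → M} (hg : EventuallyZero g) :
    EventuallyZero₂ (fun m n => rep m a (g n)) := by
  obtain ⟨A, hA⟩ := hg
  exact .of_uniform ⟨A, fun n hn m => by rw [hA n hn, hM.bil.zero_right]⟩
    fun n => hM.locality a (g n)

include hM in
lemma eventuallyZero₂_rep_left {g : ℕ → R} (hg : EventuallyZero g) (v : M) :
    EventuallyZero₂ (fun m n => rep m (g n) v) := by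
  obtain ⟨A, hA⟩ := hg
  exact .of_uniform ⟨A, fun n hn m => by rw [hA n hn, hM.bil.zero_left]⟩
    fun n => hM.locality (g n) v

include hR hM in
/-- The module axiom evaluated at a pair of commuting operators. -/
lemma opEval_module_identity {X Y : Module.End ℂ M} (hXY : Commute X Y) {i k : ZMod 2} {a b : R}
    (ha : a ∈ G i) (hb : b ∈ G k) (v : M) :
    opEval X (fun l => opEval (X + Y) (fun k => rep k (br l (be a) b) (ps v))) =
      opEval X (fun m => opEval Y (fun n => rep m (al (be a)) (rep n b v)))
        + (-sgn i k) • opEval X (fun m => opEval Y (fun n => rep n (be b) (rep m (al a) v))) := by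
  have h₁ := eventuallyZero₂_rep hM (al (be a)) (hM.locality b v)
  have h₂ := (eventuallyZero₂_rep hM (be b) (hM.locality (al a) v)).flip
  rw [← opEval_shiftCoeff hXY (eventuallyZero₂_rep_left hM (hR.locality (be a) b) (ps v)),
    ← opEval₂_smul h₂, ← opEval₂_add h₁ (h₂.smul _)]
  congr! 4 with m n
  simpa [shiftCoeff, sub_eq_add_neg] using hM.module_axiom i k m n a b v ha hb

namespace IsRightAction

include hM hT

lemma opEval_eq {X : Module.End ℂ M} (hX : Commute X DM) {j k : ZMod 2} {v : M} {r : R}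
    (hv : v ∈ GM j) (hr : r ∈ G k) :
    opEval X (fun n => T n v r) =
      (-sgn k j) • opRep hM (-X - DM) (al.symm (be r)) (ph (ps.symm v)) := by
  have hloc := hM.locality (al.symm (be r)) (ph (ps.symm v))
  simp only [hT.eq_nsub j k _ v r hv hr]
  rw [opEval_smul (EventuallyZero.nsub hloc DM), opEval_nsub hX hloc, opRep_apply]

include hR

lemma locality (v : M) (r : R) : EventuallyZero (fun n => T n v r) := by
  induction v using homogeneous_induction hM.internal with
  | add v w hv hw => simpa only [hT.add_left] using hv.add hw
  | mem j v hv =>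
    induction r using homogeneous_induction hR.internal with
    | add r s hr hs => simpa only [hT.add_right] using hr.add hs
    | mem k r hr =>
      simp only [hT.eq_nsub j k _ v r hv hr]
      exact (EventuallyZero.nsub (hM.locality _ _) DM).smul _

lemma mem_grade {j k : ZMod 2} (n : ℕ) {v : M} {r : R} (hv : v ∈ GM j) (hr : r ∈ G k) :
    T n v r ∈ GM (j + k) := by
  rw [hT.eq_nsub j k n v r hv hr, add_comm j k]
  exact (GM _).smul_mem _ (nsub_mem DM _ (hM.dm_even _) (fun p => hM.grade k j p _ _
    (symm_alpha_beta_mem hR k r hr) (phi_symm_psi_mem hM j v hv)) n)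

lemma phi_map (n : ℕ) (v : M) (r : R) : ph (T n v r) = T n (ph v) (al r) := by
  induction v using homogeneous_induction hM.internal with
  | add v w hv hw => rw [hT.add_left, map_add, hv, hw, map_add, hT.add_left]
  | mem j v hv =>
    induction r using homogeneous_induction hR.internal with
    | add r s hr hs => rw [hT.add_right, map_add, hr, hs, map_add, hT.add_right]
    | mem k r hr =>
      rw [hT.eq_nsub j k n v r hv hr,
        hT.eq_nsub j k n _ _ (phi_mem hM hv) (alpha_mem hR hr), map_smul]
      congr 1
      refine (map_nsub ph.toLinearMap (E := DM) hM.ph_dm (hM.locality _ _) n).trans ?_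
      congr 1
      funext p
      rw [hM.ph_rep]
      have h := hR.al_be_comm r
      simp only [LinearEquiv.coe_coe] at h ⊢
      rw [al.apply_symm_apply, ← h, al.symm_apply_apply, phi_symm_psi hM v]

lemma psi_map (n : ℕ) (v : M) (r : R) : ps (T n v r) = T n (ps v) (be r) := by
  induction v using homogeneous_induction hM.internal with
  | add v w hv hw => rw [hT.add_left, map_add, hv, hw, map_add, hT.add_left]
  | mem j v hv =>
    induction r using homogeneous_induction hR.internal with
    | add r s hr hs => rw [hT.add_right, map_add, hr, hs, map_add, hT.add_right]
    | mem k r hr =>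
      rw [hT.eq_nsub j k n v r hv hr,
        hT.eq_nsub j k n _ _ (psi_mem hM hv) (beta_mem hR hr), map_smul]
      congr 1
      refine (map_nsub ps.toLinearMap (E := DM) hM.ps_dm (hM.locality _ _) n).trans ?_
      congr 1
      funext p
      rw [hM.ps_rep]
      have h := hM.ph_ps_comm (ps.symm v)
      simp only [LinearEquiv.coe_coe] at h ⊢
      rw [beta_symm_alpha hR, ← h, ps.apply_symm_apply, ps.symm_apply_apply]

lemma sesq_left (n : ℕ) (v : M) (r : R) : T n (DM v) r = -prev (fun m => T m v r) n := by
  induction v using homogeneous_induction hM.internal generalizing n with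
  | add v w hv hw =>
    rw [map_add, hT.add_left, hv, hw]
    cases n <;> simp [prev, hT.add_left, add_comm]
  | mem j v hv =>
    induction r using homogeneous_induction hR.internal generalizing n with
    | add r s hr hs =>
      rw [hT.add_right, hr, hs]
      cases n <;> simp [prev, hT.add_right, add_comm]
    | mem k r hr =>
      have hloc := hT.locality hR hM v r
      have hneg := hloc.prev.map (-LinearMap.id : M →ₗ[ℂ] M)
      refine congrFun (eq_of_opEval_eq (hT.locality hR hM (DM v) r) hneg fun t => ?_) n
      have ht : Commute (algebraMap ℂ (Module.End ℂ M) t) DM := Algebra.commutes t DM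
      change _ = opEval _ (fun n => -prev (fun m => T m v r) n)
      rw [opEval_neg hloc.prev, opEval_prev hloc, hT.opEval_eq hM ht hv hr,
        hT.opEval_eq hM ht (hM.dm_even j v hv) hr, phi_symm_psi_der hM,
        opRep_der_of_commute hM (ht.neg_left.sub_left (.refl DM))]
      simpa using smul_comm _ _ _

lemma sesq_right (n : ℕ) (v : M) (r : R) :
    T n v (D r) = DM (T n v r) + prev (fun m => T m v r) n := by
  induction v using homogeneous_induction hM.internal generalizing n with
  | add v w hv hw =>
    rw [hT.add_left, hv, hw]
    cases n
    · simp [prev, hT.add_left]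
    · simp only [prev, hT.add_left, map_add]; abel
  | mem j v hv =>
    induction r using homogeneous_induction hR.internal generalizing n with
    | add r s hr hs =>
      rw [map_add, hT.add_right, hr, hs]
      cases n
      · simp [prev, hT.add_right]
      · simp only [prev, hT.add_right, map_add]; abel
    | mem k r hr =>
      have hloc := hT.locality hR hM v r
      have hD := hloc.map DM
      refine congrFun (eq_of_opEval_eq (hT.locality hR hM v (D r)) (hD.add hloc.prev)
        fun t => ?_) n
      have ht : Commute (algebraMap ℂ (Module.End ℂ M) t) DM := Algebra.commutes t DM
      have hrep : EventuallyZero _ := hM.locality (al.symm (be r)) (ph (ps.symm v))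
      rw [opEval_add hD hloc.prev, opEval_prev hloc,
        ← map_opEval DM (fun v => (LinearMap.congr_fun ht.eq v).symm) hloc,
        hT.opEval_eq hM ht hv hr, hT.opEval_eq hM ht hv (hR.der_even k r hr),
        symm_alpha_beta_der hR, opRep_apply]
      simp only [hM.sesq₁]
      rw [opEval_neg hrep.prev, opEval_prev hrep,
        ← opRep_apply hM]
      simp only [LinearMap.neg_apply, LinearMap.sub_apply, map_smul]
      module

lemma skew {j k : ZMod 2} (n : ℕ) {v : M} {r : R} (hv : v ∈ GM j) (hr : r ∈ G k) :
    T n (ps v) (al r) = -(sgn k j) • nsub DM (fun m => rep m (be r) (ph v)) n := by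
  have h := hR.al_be_comm r
  simp only [LinearEquiv.coe_coe] at h
  rw [hT.eq_nsub j k n _ _ (psi_mem hM hv) (alpha_mem hR hr), ← h, al.symm_apply_apply,
    ps.symm_apply_apply]

lemma skew_rep {j k : ZMod 2} (n : ℕ) {v : M} {r : R} (hv : v ∈ GM j) (hr : r ∈ G k) :
    rep n (be r) (ph v) = -(sgn k j) • nsub DM (fun m => T m (ps v) (al r)) n := by
  have hloc : EventuallyZero _ := hM.locality (be r) (ph v)
  simp only [hT.skew hR hM _ hv hr]
  rw [nsub_smul DM (hloc.nsub DM), nsub_nsub DM hloc, smul_smul, neg_mul_neg, sgn_mul_self,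
    one_smul]

lemma eventuallyZero₂_right (v : M) {g : ℕ → R} (hg : EventuallyZero g) :
    EventuallyZero₂ (fun m n => T m v (g n)) := by
  obtain ⟨A, hA⟩ := hg
  exact .of_uniform ⟨A, fun n hn m => by rw [hA n hn, hT.zero_right]⟩
    fun n => hT.locality hR hM v (g n)

lemma eventuallyZero₂_left {g : ℕ → M} (hg : EventuallyZero g) (r : R) :
    EventuallyZero₂ (fun m n => T m (g n) r) := by
  obtain ⟨A, hA⟩ := hg
  exact .of_uniform ⟨A, fun n hn m => by rw [hA n hn, hT.zero_left]⟩
    fun n => hT.locality hR hM (g n) r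

/-- The BiHom-Jacobi identity for `r ∈ R`, `v ∈ M`, `c ∈ R`. -/
lemma jacobi_middle (i j : ZMod 2) (m n : ℕ) (r : R) (v : M) (c : R)
    (hr : r ∈ G i) (hv : v ∈ GM j) :
    rep m (al (be r)) (T n v c) =
      shiftCoeff (fun k l => T k (rep l (be r) v) (be c)) m n
        + sgn i j • T n (ps v) (br m (al r) c) := by
  induction c using homogeneous_induction hR.internal with
  | add c d hc hd =>
    rw [hT.add_right, hM.bil.add_right, hc, hd, hR.bil.add_right, hT.add_right]
    simp only [shiftCoeff, map_add, hT.add_right, smul_add, sum_add_distrib]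
    abel
  | mem k c hc =>
    have hl := eventuallyZero₂_rep hM (al (be r)) (hT.locality hR hM v c)
    have hF := hT.eventuallyZero₂_left hR hM (hM.locality (be r) v) (be c)
    have hB := (hT.eventuallyZero₂_right hR hM (ps v) (hR.locality (al r) c)).flip
    refine congrFun (congrFun (eq_of_opEval₂_eq hl (hF.shiftCoeff.add (hB.smul (sgn i j)))
      fun t u => ?_) m) n
    have hX (Z : Module.End ℂ M) : Commute (algebraMap ℂ (Module.End ℂ M) t) Z :=
      Algebra.commutes t Z
    have hU (Z : Module.End ℂ M) : Commute (algebraMap ℂ (Module.End ℂ M) u) Z :=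
      Algebra.commutes u Z
    have hXs (v : M) : algebraMap ℂ (Module.End ℂ M) t v = t • v := rfl
    have hUs (v : M) : algebraMap ℂ (Module.End ℂ M) u v = u • v := rfl
    generalize algebraMap ℂ (Module.End ℂ M) t = X at *
    generalize algebraMap ℂ (Module.End ℂ M) u = U at *
    have key := opEval_module_identity hR hM (hX (-(X + U) - DM)) hr
      (symm_alpha_beta_mem hR k c hc) (ph (ps.symm v))
    rw [show X + (-(X + U) - DM) = -U - DM by abel] at key
    have e₁ : opEval X (fun m => opEval U (fun n => rep m (al (be r)) (T n v c))) =
        (-sgn k j) • opEval X (fun m => opEval (-(X + U) - DM) (fun n =>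
          rep m (al (be r)) (rep n (al.symm (be c)) (ph (ps.symm v))))) := by
      rw [opEval_comm (hX U) hl, opEval_comm (hX _)
        (eventuallyZero₂_rep hM (al (be r)) (hM.locality (al.symm (be c)) (ph (ps.symm v))))]
      simp only [← opRep_apply hM X]
      rw [← map_opEval (opRep hM X (al (be r))) (X := U) (by simp [hUs])
          (hT.locality hR hM v c),
        hT.opEval_eq hM (hU DM) hv hc, map_smul, opRep_apply hM (-U - DM),
        map_opEval (opRep hM X (al (be r))) (Y := -(X + U) - DM) _ (hM.locality _ _)]
      intro w
      simp only [LinearMap.sub_apply, LinearMap.neg_apply, LinearMap.add_apply, map_sub, map_neg,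
        opRep_der_of_commute hM (hX DM), hUs, map_smul]
      abel
    have e₂ : opEval X (fun l => opEval (X + U) (fun k => T k (rep l (be r) v) (be c))) =
        (-(sgn k i * sgn k j)) • opEval X (fun m => opEval (-(X + U) - DM) (fun n =>
          rep n (be (al.symm (be c))) (rep m (al r) (ph (ps.symm v))))) := by
      rw [← opEval_smul ((eventuallyZero₂_rep hM _ (hM.locality _ _)).flip.opEval _)]
      congr! 2 with l
      rw [hT.opEval_eq hM ((hX DM).add_left (hU DM))
        (hM.grade i j l _ _ (beta_mem hR hr) hv) (beta_mem hR hc), opRep_apply,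
        phi_symm_psi_rep hM, sgn_add_right, beta_symm_alpha hR]
    have e₃ : opEval X (fun m => opEval U (fun n => T n (ps v) (br m (al r) c))) =
        (-(sgn i j * sgn k j)) • opEval X (fun l => opEval (-U - DM) (fun k =>
          rep k (br l (be r) (al.symm (be c))) (ps (ph (ps.symm v))))) := by
      rw [← opEval_smul ((eventuallyZero₂_rep_left hM (hR.locality _ _) _).flip.opEval _)]
      congr! 2 with l
      rw [hT.opEval_eq hM (hU DM) (psi_mem hM hv)
        (hR.grade i k l _ _ (alpha_mem hR hr) hc), opRep_apply, sgn_add_left]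
      rw [symm_alpha_beta_br hR, phi_symm_psi_psi hM]
    rw [opEval₂_add hF.shiftCoeff (hB.smul _), opEval₂_smul hB, opEval_shiftCoeff (hX U) hF,
      e₁, e₂, e₃, key, sgn_comm k i]
    have hs : sgn i j * -(sgn i j * sgn k j) = -sgn k j := by
      linear_combination -sgn k j * sgn_mul_self i j
    rw [smul_smul (sgn i j), hs]
    module

/-- The BiHom-Jacobi identity for `v ∈ M`, `b ∈ R`, `c ∈ R`. -/
lemma jacobi_last (j i : ZMod 2) (m n : ℕ) (v : M) (b c : R)
    (hv : v ∈ GM j) (hb : b ∈ G i) :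
    T m (ph (ps v)) (br n b c) =
      shiftCoeff (fun k l => T k (T l (ps v) b) (be c)) m n
        + sgn j i • rep n (be b) (T m (ph v) c) := by
  induction c using homogeneous_induction hR.internal with
  | add c d hc hd =>
    rw [hR.bil.add_right, hT.add_right, hc, hd, hT.add_right, hM.bil.add_right]
    simp only [shiftCoeff, map_add, hT.add_right, smul_add, sum_add_distrib]
    abel
  | mem k c hc =>
    have hl := hT.eventuallyZero₂_right hR hM (ph (ps v)) (hR.locality b c)
    have hF := hT.eventuallyZero₂_left hR hM (hT.locality hR hM (ps v) b) (be c)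
    have hB := (eventuallyZero₂_rep hM (be b) (hT.locality hR hM (ph v) c)).flip
    refine congrFun (congrFun (eq_of_opEval₂_eq hl (hF.shiftCoeff.add (hB.smul (sgn j i)))
      fun t u => ?_) m) n
    have hX (Z : Module.End ℂ M) : Commute (algebraMap ℂ (Module.End ℂ M) t) Z :=
      Algebra.commutes t Z
    have hU (Z : Module.End ℂ M) : Commute (algebraMap ℂ (Module.End ℂ M) u) Z :=
      Algebra.commutes u Z
    have hXs (v : M) : algebraMap ℂ (Module.End ℂ M) t v = t • v := rfl
    have hUs (v : M) : algebraMap ℂ (Module.End ℂ M) u v = u • v := rfl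
    generalize algebraMap ℂ (Module.End ℂ M) t = X at *
    generalize algebraMap ℂ (Module.End ℂ M) u = U at *
    obtain ⟨a, rfl⟩ := al.surjective b
    have ha : a ∈ G i := by
      simpa using symm_mem_of_even hR.internal al hR.al_even i _ hb
    have hY : Commute (-(X + U) - DM) DM :=
      ((hX DM).add_left (hU DM)).neg_left.sub_left (.refl DM)
    have hac := hR.al_be_comm a
    have hcomm := hM.ph_ps_comm v
    simp only [LinearEquiv.coe_coe] at hac hcomm
    have key := opEval_module_identity hR hM (hU (-(X + U) - DM)) ha
      (symm_alpha_beta_mem hR k c hc) (ph (ps.symm (ph v)))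
    rw [show U + (-(X + U) - DM) = -X - DM by abel] at key
    have e₁ : opEval X (fun m => opEval U (fun n => T m (ph (ps v)) (br n (al a) c))) =
        (-(sgn i j * sgn k j)) • opEval U (fun l => opEval (-X - DM) (fun k =>
          rep k (br l (be a) (al.symm (be c))) (ps (ph (ps.symm (ph v)))))) := by
      rw [opEval_comm (hX U) hl,
        ← opEval_smul ((eventuallyZero₂_rep_left hM (hR.locality _ _) _).flip.opEval _)]
      congr! 2 with l
      rw [hT.opEval_eq hM (hX DM) (phi_mem hM (psi_mem hM hv))
        (hR.grade i k l _ _ hb hc), opRep_apply, sgn_add_left, symm_alpha_beta_br hR,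
        hcomm, phi_symm_psi_psi hM]
    have e₂ : opEval X (fun l => opEval (X + U) (fun k => T k (T l (ps v) (al a)) (be c))) =
        (sgn k j * sgn k i * sgn i j) • opEval U (fun m => opEval (-(X + U) - DM) (fun n =>
          rep n (be (al.symm (be c))) (rep m (al a) (ph (ps.symm (ph v)))))) := by
      let K : Module.End ℂ M := opRep hM (-(X + U) - DM) (al.symm (be (be c))) ∘ₗ
        ph.toLinearMap ∘ₗ ps.symm.toLinearMap
      have hKdef (w : M) :
        K w = opRep hM (-(X + U) - DM) (al.symm (be (be c))) (ph (ps.symm w)) := rfl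
      have hK (w : M) : K ((-X - DM) w) = U (K w) := by
        simp only [LinearMap.sub_apply, LinearMap.neg_apply, map_sub, map_neg, hXs, map_smul]
        rw [hKdef (DM w), phi_symm_psi_der hM, opRep_der_of_commute hM hY, ← hKdef]
        simp only [LinearMap.sub_apply, LinearMap.neg_apply, LinearMap.add_apply, hXs]
        abel
      have hT₂ (l : ℕ) : opEval (X + U) (fun k => T k (T l (ps v) (al a)) (be c)) =
          (-(sgn k j * sgn k i)) • K (T l (ps v) (al a)) := by
        rw [hT.opEval_eq hM ((hX DM).add_left (hU DM)) (hT.mem_grade hR hM l (psi_mem hM hv) hb)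
          (beta_mem hR hc), sgn_add_right, hKdef]
      simp only [hT₂]
      rw [opEval_smul ((hT.locality hR hM (ps v) (al a)).map K),
        ← map_opEval K (X := X) (by simp [hXs]) (hT.locality hR hM (ps v) (al a)),
        hT.opEval_eq hM (hX DM) (psi_mem hM hv) hb, map_smul, opRep_apply hM (-X - DM),
        map_opEval K hK (hM.locality _ _), smul_smul, neg_mul_neg]
      congr! 4 with l
      rw [hKdef, opRep_apply, ← hac, al.symm_apply_apply, phi_symm_psi_rep hM,
        ps.symm_apply_apply, beta_symm_alpha hR]
    have e₃ : opEval X (fun m => opEval U (fun n => rep n (be (al a)) (T m (ph v) c))) =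
        (-sgn k j) • opEval U (fun m => opEval (-(X + U) - DM) (fun n =>
          rep m (al (be a)) (rep n (al.symm (be c)) (ph (ps.symm (ph v)))))) := by
      have hYr := eventuallyZero₂_rep hM (al (be a))
        (hM.locality (al.symm (be c)) (ph (ps.symm (ph v))))
      rw [opEval_comm (hU _) hYr]
      simp only [← opRep_apply hM U]
      rw [← map_opEval (opRep hM U (be (al a))) (X := X) (by simp [hXs])
          (hT.locality hR hM (ph v) c),
        hT.opEval_eq hM (hX DM) (phi_mem hM hv) hc, map_smul, opRep_apply hM (-X - DM),
        map_opEval (opRep hM U (be (al a))) (Y := -(X + U) - DM) _ (hM.locality _ _), hac]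
      intro w
      simp only [LinearMap.sub_apply, LinearMap.neg_apply, LinearMap.add_apply, map_sub, map_neg,
        opRep_der_of_commute hM (hU DM), hXs, map_smul]
      abel
    rw [opEval₂_add hF.shiftCoeff (hB.smul _), opEval₂_smul hB, opEval_shiftCoeff (hX U) hF,
      e₁, e₂, e₃, key, sgn_comm k i, sgn_comm j i]
    have hs : sgn i j * -(sgn i j * sgn k j) = -sgn k j := by
      linear_combination -sgn k j * sgn_mul_self i j
    module

end IsRightAction

end

end Semidirect

/-- Let `(R, α, β)` be a regular BiHom-Lie conformal superalgebra and
`(M, φ, ψ)` a BiHom-conformal module of `R` with representation `ρ`, where `φ` and `ψ`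
are invertible. Define on `R ⊕ M`, with grading `(R ⊕ M)_θ = R_θ ⊕ M_θ`, the λ-bracket
`[(r + m)_λ (r′ + m′)]_M = [r_λ r′] + ρ(r)_λ m′ − (−1)^{|r′||m|} ρ(α^{−1}β(r′))_{−∂−λ} (φψ^{−1}(m))`.
Then `(R ⊕ M, [·_λ·]_M, α + φ, β + ψ)` is a BiHom-Lie conformal superalgebra
(the semidirect product `R ⋉_ρ M`). (The bracket `brM` is the bilinear map determined by
this formula on pairs whose components are homogeneous.) -/
theorem semidirectProduct_isBiHomLieConfSuperAlg {R M : Type*}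
    [AddCommGroup R] [Module ℂ R] [AddCommGroup M] [Module ℂ M]
    (G : ZMod 2 → Submodule ℂ R) (D : Module.End ℂ R) (al be : R ≃ₗ[ℂ] R)
    (br : ℕ → R → R → R)
    (hR : IsBiHomLieConfSuperAlg G D al.toLinearMap be.toLinearMap br)
    (GM : ZMod 2 → Submodule ℂ M) (DM : Module.End ℂ M) (ph ps : M ≃ₗ[ℂ] M)
    (rep : ℕ → R → M → M)
    (hM : IsBiHomConfRep G D al.toLinearMap be.toLinearMap br
      GM DM ph.toLinearMap ps.toLinearMap rep)
    (brM : ℕ → R × M → R × M → R × M) (hbil : IsBil brM)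
    (hbrM : ∀ (jm i' : ZMod 2) (r r' : R) (m m' : M) (n : ℕ),
      m ∈ GM jm → r' ∈ G i' →
      brM n (r, m) (r', m') =
        (br n r r',
          rep n r m'
            - sgn i' jm • nsub DM (fun p => rep p (al.symm (be r')) (ph (ps.symm m))) n)) :
    IsBiHomLieConfSuperAlg (fun θ => (G θ).prod (GM θ)) (D.prodMap DM)
      (al.toLinearMap.prodMap ph.toLinearMap) (be.toLinearMap.prodMap ps.toLinearMap)
      brM := by
  let T (n : ℕ) (v : M) (r : R) : M := (brM n (0, v) (r, 0)).2
  have hT : IsRightAction G al be GM DM ph ps rep T := by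
    refine ⟨fun n v w r => ?_, fun n v r r' => ?_, fun j k n v r hv hr => ?_⟩
    · simpa [T] using congrArg Prod.snd (hbil.add_left n (0, v) (0, w) (r, 0))
    · simpa [T] using congrArg Prod.snd (hbil.add_right n (0, v) (r, 0) (r', 0))
    · simp [T, hbrM j k 0 r v 0 n hv hr, hM.bil.zero_left]
  have hloc := hT.locality hR hM
  have hbr (n : ℕ) (x y : R × M) :
      brM n x y = (br n x.1 y.1, rep n x.1 y.2 + T n x.2 y.1) := by
    obtain ⟨r, v⟩ := x
    obtain ⟨s, w⟩ := y
    induction v using homogeneous_induction hM.internal generalizing r s w with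
    | add v v' hv hv' =>
      have h := hbil.add_left n (r, v) (0, v') (s, w)
      rw [hv, hv'] at h
      simpa [hT.add_left, hR.bil.zero_left, hM.bil.zero_left, add_assoc] using h
    | mem j v hv =>
      induction s using homogeneous_induction hR.internal generalizing w with
      | add s s' hs hs' =>
        have h := hbil.add_right n (r, v) (s, w) (s', 0)
        rw [hs, hs'] at h
        simpa [hT.add_right, hR.bil.add_right, hM.bil.zero_right, add_assoc] using h
      | mem k s hs =>
        rw [hbrM j k r s v w n hv hs, hT.eq_nsub j k n v s hv hs, neg_smul, sub_eq_add_neg]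
  exact
  { internal := isInternal_prod hR.internal hM.internal
    der_even := fun i x hx => ⟨hR.der_even i _ hx.1, hM.dm_even i _ hx.2⟩
    al_even := fun i x hx => ⟨hR.al_even i _ hx.1, hM.ph_even i _ hx.2⟩
    be_even := fun i x hx => ⟨hR.be_even i _ hx.1, hM.ps_even i _ hx.2⟩
    al_be_comm := fun x => Prod.ext (hR.al_be_comm _) (hM.ph_ps_comm _)
    al_der := fun x => Prod.ext (hR.al_der _) (hM.ph_dm _)
    be_der := fun x => Prod.ext (hR.be_der _) (hM.ps_dm _)
    bil := hbil
    grade := fun i j n x y hx hy => by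
      rw [hbr]
      exact ⟨hR.grade i j n _ _ hx.1 hy.1, (GM _).add_mem (hM.grade i j n _ _ hx.1 hy.2)
        (hT.mem_grade hR hM n hx.2 hy.1)⟩
    locality := fun x y => by
      obtain ⟨A, hA⟩ := hR.locality x.1 y.1
      obtain ⟨B, hB⟩ := EventuallyZero.add (hM.locality x.1 y.2) (hloc x.2 y.1)
      exact ⟨max A B, fun n hn => (hbr n x y).trans (Prod.ext
        (hA n (le_trans (le_max_left _ _) hn)) (hB n (le_trans (le_max_right _ _) hn)))⟩
    al_br := fun n x y => by
      rw [hbr, hbr]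
      refine Prod.ext (hR.al_br n _ _) ?_
      simpa [hT.phi_map hR hM] using hM.ph_rep n x.1 y.2
    be_br := fun n x y => by
      rw [hbr, hbr]
      refine Prod.ext (hR.be_br n _ _) ?_
      simpa [hT.psi_map hR hM] using hM.ps_rep n x.1 y.2
    sesq₁ := fun n x y => by
      have h₁ := hR.sesq₁ n x.1 y.1
      have h₂ := hM.sesq₁ n x.1 y.2
      have h₃ := hT.sesq_left hR hM n x.2 y.1
      simp only [hbr, LinearMap.prodMap_apply, h₁, h₂, h₃]
      cases n <;> simp [prev, add_comm]
    sesq₂ := fun n x y => by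
      have h₁ := hR.sesq₂ n x.1 y.1
      have h₂ := hM.sesq₂ n x.1 y.2
      have h₃ := hT.sesq_right hR hM n x.2 y.1
      simp only [hbr, LinearMap.prodMap_apply, h₁, h₂, h₃]
      cases n
      · simp [prev]
      · simp only [prev, Prod.mk_add_mk, map_add, Prod.mk.injEq, true_and]
        abel
    skew := fun i j n x y hx hy => by
      simp only [hbr, LinearMap.prodMap_apply, LinearEquiv.coe_coe]
      have hy₁ : EventuallyZero _ := hM.locality (be y.1) (ph x.2)
      have hxy : EventuallyZero (fun m => (br m (be y.1) (al x.1),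
          rep m (be y.1) (ph x.2) + T m (ps y.2) (al x.1))) := by
        obtain ⟨A, hA⟩ := hR.locality (be y.1) (al x.1)
        obtain ⟨B, hB⟩ := hy₁.add (hloc (ps y.2) (al x.1))
        exact ⟨max A B, fun n hn => Prod.ext (hA n (le_trans (le_max_left _ _) hn))
          (hB n (le_trans (le_max_right _ _) hn))⟩
      have h₁ := map_nsub (LinearMap.fst ℂ R M) (D := D.prodMap DM) (E := D) (by simp) hxy n
      have h₂ := map_nsub (LinearMap.snd ℂ R M) (D := D.prodMap DM) (E := DM) (by simp) hxy n
      simp only [LinearMap.fst_apply, LinearMap.snd_apply] at h₁ h₂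
      rw [nsub_add DM hy₁ (hloc _ _)] at h₂
      refine Prod.ext ?_ ?_
      · rw [Prod.smul_fst, h₁]
        exact hR.skew i j n _ _ hx.1 hy.1
      · rw [Prod.smul_snd, h₂, hT.skew_rep hR hM n hy.2 hx.1, hT.skew hR hM n hx.2 hy.1,
          smul_add, sgn_comm j i, add_comm]
    jacobi := fun i j m n x y z hx hy => by
      have h₁ := hR.jacobi i j m n x.1 y.1 z.1 hx.1 hy.1
      have h₂ := hM.module_axiom i j m n x.1 y.1 z.2 hx.1 hy.1
      have h₃ := hT.jacobi_middle hR hM i j m n x.1 y.2 z.1 hx.1 hy.2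
      have h₄ := hT.jacobi_last hR hM i j m n x.2 y.1 z.1 hx.2 hy.1
      simp only [LinearEquiv.coe_coe, shiftCoeff] at h₁ h₂ h₃ h₄
      simp only [hbr, LinearMap.prodMap_apply, LinearEquiv.coe_coe]
      refine Prod.ext ?_ ?_
      · simp [h₁, Prod.fst_sum]
      · simp only [Prod.snd_add, Prod.snd_sum, Prod.smul_snd, smul_add, hT.add_left,
          sum_add_distrib, h₂, h₃, h₄, hM.bil.add_right]
        abel }
end
end
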